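/- arXiv:1901.06866 — 2 statements merged into one kernel-verified Lean document; each statement's English description precedes it below -/
import Mathlib

section
/- Fix β ∈ (0,1). There is no θ < 1/2 such that Σ_{(m,n) : m, n ≥ 1, m · n^{1/β} ≤ x} μ(m)μ(n) = O(x^θ) as x → ∞. Equivalently, the infimum of all θ for which this bound holds is at least 1/2. -/
open Filter Asymptotics ArithmeticFunction

/-- The number of pairs (m,n) of positive integers with m · n^{1/β} ≤ x. -/
noncomputable def pairCount (β x : ℝ) : ℕ :=
  Nat.card {mn : ℕ × ℕ | 0 < mn.1 ∧ 0 < mn.2 ∧ (mn.1 : ℝ) * (mn.2 : ℝ) ^ (1/β) ≤ x}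

/-- Mertens function M(y) = Σ_{k ≤ y} μ(k) (equal to 0 for y < 1). -/
noncomputable def Mob (y : ℝ) : ℤ :=
  ∑ k ∈ Finset.Icc 1 ⌊y⌋₊, moebius k

/-- Σ_{(m,n) : m,n ≥ 1, m·n^{1/β} ≤ x} μ(m)·μ(n) (a finite sum for each x). -/
noncomputable def MobPairSum (β x : ℝ) : ℤ :=
  ∑ᶠ mn ∈ {mn : ℕ × ℕ | 0 < mn.1 ∧ 0 < mn.2 ∧ (mn.1 : ℝ) * (mn.2 : ℝ) ^ (1/β) ≤ x},
    moebius mn.1 * moebius mn.2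

section PartA
open Complex MeasureTheory Set HurwitzZeta

/-- the modified theta kernel -/
noncomputable def psiK : ℝ → ℂ := (hurwitzEvenFEPair 0).f_modif

lemma evenKernel_zero_sub_nonneg {t : ℝ} (ht : 0 < t) : 0 ≤ evenKernel 0 t - 1 := by
  have h := hasSum_int_evenKernel₀ 0 ht
  simp only [QuotientAddGroup.mk_zero, if_true] at h
  refine h.nonneg fun n => ?_
  split_ifs
  · exact le_rfl
  · positivity

lemma psiK_nonneg {t : ℝ} (ht : 0 < t) : ∃ r : ℝ, 0 ≤ r ∧ psiK t = (r : ℂ) := by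
  have key : ∀ x : ℝ, 1 < x → (hurwitzEvenFEPair 0).f_modif x = ((evenKernel 0 x - 1 : ℝ) : ℂ) ∧
      (hurwitzEvenFEPair 0).g_modif x = ((evenKernel 0 x - 1 : ℝ) : ℂ) := by
    intro x hx
    constructor
    · simp [WeakFEPair.f_modif, hx, hx.le, hurwitzEvenFEPair]
    · simp [WeakFEPair.g_modif, hx, hx.le, hurwitzEvenFEPair, evenKernel_eq_cosKernel_of_zero]
  rcases lt_trichotomy t 1 with h | h | h
  · have hx : 1 < 1 / t := by rwa [lt_one_div one_pos ht, div_one]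
    have hx0 : 0 < 1 / t := by positivity
    have h1 := (hurwitzEvenFEPair 0).hf_modif_FE (1 / t) hx0
    rw [one_div_one_div, (key _ hx).2] at h1
    refine ⟨(1 / t) ^ (1 / 2 : ℝ) * (evenKernel 0 (1 / t) - 1),
      mul_nonneg (by positivity) (evenKernel_zero_sub_nonneg hx0), ?_⟩
    rw [psiK, h1]
    simp [hurwitzEvenFEPair]
  · refine ⟨0, le_rfl, ?_⟩
    simp [psiK, WeakFEPair.f_modif, h]
  · exact ⟨_, evenKernel_zero_sub_nonneg ht, (key t h).1⟩

lemma psiK_eq_norm {t : ℝ} (ht : 0 < t) : psiK t = (‖psiK t‖ : ℂ) := by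
  obtain ⟨r, hr, h⟩ := psiK_nonneg ht
  rw [h, Complex.norm_real, Real.norm_of_nonneg hr]

lemma psiK_conv (s : ℂ) : MellinConvergent psiK s :=
  ((hurwitzEvenFEPair 0).isStrongFEPair_toStrongFEPair.hasMellin s).1

lemma zeta0_eq (s : ℂ) : completedRiemannZeta₀ s = mellin psiK (s / 2) / 2 := rfl

lemma psiK_int (σ : ℝ) : IntegrableOn (fun t : ℝ => t ^ (σ - 1) * ‖psiK t‖) (Ioi 0) := by
  have h : IntegrableOn (fun t : ℝ => ‖(t : ℂ) ^ ((σ : ℂ) - 1) • psiK t‖) (Ioi 0) := (psiK_conv σ).norm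
  refine h.congr_fun (fun t ht => ?_) measurableSet_Ioi
  simp only [norm_smul]
  rw [Complex.norm_cpow_eq_rpow_re_of_pos ht]
  simp

lemma mellin_psiK_real (σ : ℝ) :
    mellin psiK σ = ((∫ t in Ioi (0:ℝ), t ^ (σ - 1) * ‖psiK t‖ : ℝ) : ℂ) := by
  rw [mellin, ← integral_complex_ofReal]
  refine setIntegral_congr_fun measurableSet_Ioi fun t ht => ?_
  simp only [smul_eq_mul, ofReal_mul]
  rw [← psiK_eq_norm ht, ofReal_cpow (le_of_lt ht)]
  simp

lemma mellin_psiK_le (s : ℂ) (a b : ℝ) (ha : a ≤ s.re) (hb : s.re ≤ b) :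
    ‖mellin psiK s‖ ≤ ‖mellin psiK a‖ + ‖mellin psiK b‖ := by
  have hn : ∀ σ : ℝ, ‖mellin psiK σ‖ = ∫ t in Ioi (0:ℝ), t ^ (σ - 1) * ‖psiK t‖ := by
    intro σ
    rw [mellin_psiK_real, Complex.norm_real, Real.norm_of_nonneg]
    refine setIntegral_nonneg measurableSet_Ioi fun t ht => ?_
    have : (0:ℝ) < t := ht
    positivity
  rw [hn, hn, ← integral_add (psiK_int a) (psiK_int b)]
  refine (norm_integral_le_integral_norm _).trans ?_
  refine setIntegral_mono_on (psiK_conv s).norm ((psiK_int a).add (psiK_int b))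
    measurableSet_Ioi fun t ht => ?_
  have ht0 : (0:ℝ) < t := ht
  rw [norm_smul, Complex.norm_cpow_eq_rpow_re_of_pos ht0, ← add_mul]
  refine mul_le_mul_of_nonneg_right ?_ (norm_nonneg _)
  have p1 : 0 < t ^ (a - 1) := Real.rpow_pos_of_pos ht0 _
  have p2 : 0 < t ^ (b - 1) := Real.rpow_pos_of_pos ht0 _
  rcases le_total t 1 with h | h
  · have := Real.rpow_le_rpow_of_exponent_ge ht0 h (show a - 1 ≤ (s - 1).re by simpa using ha)
    linarith
  · have := Real.rpow_le_rpow_of_exponent_le h (show (s - 1).re ≤ b - 1 by simpa using hb)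
    linarith

lemma zeta0_le (s : ℂ) (N : ℝ) (h1 : 1 - 2 * N ≤ s.re) (h2 : s.re ≤ 2 * N) :
    ‖completedRiemannZeta₀ s‖ ≤ 2 * ‖completedRiemannZeta₀ (2 * N)‖ := by
  have h := mellin_psiK_le (s / 2) ((1 - 2 * N) / 2) N (by simp; linarith) (by simp; linarith)
  have e1 : completedRiemannZeta₀ (2 * N) = mellin psiK N / 2 := by
    rw [zeta0_eq]; congr 2; ring
  have e2 : completedRiemannZeta₀ (2 * N) = mellin psiK ((1 - 2 * N) / 2 : ℝ) / 2 := by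
    rw [← completedRiemannZeta₀_one_sub, zeta0_eq]; push_cast; rfl
  have n1 := congrArg norm e1
  have n2 := congrArg norm e2
  rw [norm_div, Complex.norm_two] at n1 n2
  rw [zeta0_eq, norm_div, Complex.norm_two]
  linarith

end PartA
section PartB
open Complex Set

lemma norm_zeta_two_mul_le (N : ℕ) (hN : 1 ≤ N) : ‖riemannZeta (2 * N)‖ ≤ 2 := by
  have h := zeta_nat_eq_tsum_of_gt_one (k := 2 * N) (by omega)
  push_cast at h
  rw [h]
  have hs : HasSum (fun n : ℕ => (1:ℝ) / (n:ℝ) ^ 2) (Real.pi ^ 2 / 6) := hasSum_zeta_two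
  refine (tsum_of_norm_bounded hs fun n => ?_).trans ?_
  · rw [norm_div, norm_one, norm_pow, Complex.norm_natCast]
    rcases Nat.eq_zero_or_pos n with rfl | hn
    · have : 2 * N ≠ 0 := by omega
      simp [this]
    · have : (1:ℝ) ≤ n := by exact_mod_cast hn
      exact one_div_le_one_div_of_le (by positivity) (pow_le_pow_right₀ this (by omega))
  · nlinarith [Real.pi_lt_d2, Real.pi_pos]

lemma norm_completed_le (N : ℕ) (hN : 1 ≤ N) : ‖completedRiemannZeta (2 * N)‖ ≤ 2 * (N : ℝ) ^ N := by
  have hne : (2 * N : ℂ) ≠ 0 := by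
    have : (N : ℂ) ≠ 0 := by exact_mod_cast (by omega : N ≠ 0)
    simpa using this
  have hre : 0 < (2 * N : ℂ).re := by
    have : (0:ℝ) < N := by exact_mod_cast hN
    simpa using this
  have h := riemannZeta_def_of_ne_zero hne
  have hG : Gammaℝ (2 * N) ≠ 0 := Gammaℝ_ne_zero_of_re_pos hre
  have e : completedRiemannZeta (2 * N) = Gammaℝ (2 * N) * riemannZeta (2 * N) := by
    rw [h]; field_simp
  have hGn : ‖Gammaℝ (2 * N)‖ ≤ (N:ℝ) ^ N := by
    rw [Gammaℝ_def, norm_mul]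
    obtain ⟨k, rfl⟩ : ∃ k, N = k + 1 := ⟨N - 1, by omega⟩
    have e2 : (2 * ((k + 1 : ℕ) : ℂ) / 2) = (k : ℂ) + 1 := by push_cast; ring
    rw [e2, Complex.Gamma_nat_eq_factorial, Complex.norm_natCast]
    have h1 : ‖(Real.pi : ℂ) ^ (-(2 * ((k + 1 : ℕ) : ℂ)) / 2)‖ ≤ 1 := by
      rw [Complex.norm_cpow_eq_rpow_re_of_pos Real.pi_pos]
      refine Real.rpow_le_one_of_one_le_of_nonpos (by linarith [Real.pi_gt_three]) ?_
      rw [neg_div, e2]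
      simp
      linarith [(Nat.cast_nonneg k : (0:ℝ) ≤ k)]
    have h2 : (k.factorial : ℝ) ≤ ((k + 1 : ℕ) : ℝ) ^ (k + 1) := by
      exact_mod_cast (Nat.factorial_le (Nat.le_succ k)).trans (Nat.factorial_le_pow _)
    calc _ ≤ 1 * ((k + 1 : ℕ) : ℝ) ^ (k + 1) := by gcongr
      _ = _ := by ring
  rw [e, norm_mul]
  calc _ ≤ (N:ℝ) ^ N * 2 := by
        gcongr
        exact norm_zeta_two_mul_le N hN
    _ = _ := by ring

lemma norm_zeta0_two_mul_le (N : ℕ) (hN : 1 ≤ N) :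
    ‖completedRiemannZeta₀ (2 * N)‖ ≤ 4 * (N : ℝ) ^ N := by
  have hN' : (1:ℝ) ≤ N := by exact_mod_cast hN
  have e : completedRiemannZeta₀ (2 * N) = completedRiemannZeta (2 * N)
      + ((1 / (2 * N) + 1 / (1 - 2 * N) : ℝ) : ℂ) := by
    rw [completedRiemannZeta_eq]; push_cast; ring
  rw [e]
  refine (norm_add_le _ _).trans ?_
  have h1 := norm_completed_le N hN
  have h2 : ‖((1 / (2 * N) + 1 / (1 - 2 * N) : ℝ) : ℂ)‖ ≤ 2 := by
    rw [Complex.norm_real, Real.norm_eq_abs, abs_le]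
    have a1 : (0:ℝ) < 1 / (2 * N) := by positivity
    have a2 : 1 / (2 * (N:ℝ)) ≤ 1 := by rw [div_le_one (by positivity)]; linarith
    have a3 : 1 / (1 - 2 * (N:ℝ)) ≤ 0 := by
      apply div_nonpos_of_nonneg_of_nonpos <;> linarith
    have a4 : -1 ≤ 1 / (1 - 2 * (N:ℝ)) := by
      rw [le_div_iff_of_neg (by linarith)]; linarith
    constructor <;> linarith
  have h3 : (1:ℝ) ≤ (N:ℝ) ^ N := one_le_pow₀ hN'
  linarith

/-- The Riemann xi function (without factor 1/2). -/
noncomputable def xiF (s : ℂ) : ℂ := s * (s - 1) * completedRiemannZeta₀ s + 1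

lemma xiF_diff : Differentiable ℂ xiF := by
  have := differentiable_completedZeta₀
  unfold xiF
  fun_prop

lemma xiF_eq {s : ℂ} (h0 : s ≠ 0) (h1 : s ≠ 1) : xiF s = s * (s - 1) * completedRiemannZeta s := by
  have : 1 - s ≠ 0 := sub_ne_zero.2 (Ne.symm h1)
  rw [completedRiemannZeta_eq, xiF]
  field_simp
  ring

lemma xiF_le (N : ℕ) (hN : 1 ≤ N) (s : ℂ) (hs : ‖s‖ ≤ 2 * N - 1) :
    ‖xiF s‖ ≤ 33 * (N : ℝ) ^ (N + 2) := by
  have hN' : (1:ℝ) ≤ N := by exact_mod_cast hN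
  have hre := abs_le.1 (Complex.abs_re_le_norm s)
  have h := zeta0_le s N (by linarith [hre.1]) (by linarith [hre.2])
  have h2 := norm_zeta0_two_mul_le N hN
  have h3 : ‖s - 1‖ ≤ 2 * N := by
    refine (norm_sub_le _ _).trans ?_
    rw [norm_one]; linarith
  have h4 : ‖completedRiemannZeta₀ s‖ ≤ 8 * (N : ℝ) ^ N := by
    rw [ofReal_natCast] at h
    linarith
  have h5 : (1:ℝ) ≤ (N:ℝ) ^ (N + 2) := one_le_pow₀ hN'
  unfold xiF
  refine (norm_add_le _ _).trans ?_
  rw [norm_mul, norm_mul, norm_one]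
  have : ‖s‖ * ‖s - 1‖ * ‖completedRiemannZeta₀ s‖ ≤ (2 * N) * (2 * N) * (8 * (N : ℝ) ^ N) := by
    gcongr
    linarith
  have e : (2 * N) * (2 * N) * (8 * (N : ℝ) ^ N) = 32 * (N:ℝ) ^ (N + 2) := by ring
  linarith

lemma affine_of_growth (g : ℂ → ℂ) (hg : Differentiable ℂ g) (C : ℝ)
    (h : ∀ n : ℕ, 1 ≤ n → ∀ z, ‖z‖ ≤ (n:ℝ) ^ 2 → ‖g z‖ ≤ C * (n:ℝ) ^ 3) :
    ∃ a b : ℂ, ∀ z, g z = a + b * z := by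
  have hg' : Differentiable ℂ (deriv g) :=
    (hg.contDiff (n := 2)).differentiable_deriv_two
  have h2 : ∀ c, deriv (deriv g) c = 0 := by
    intro c
    have hb : ∀ᶠ n : ℕ in atTop, ‖deriv (deriv g) c‖ ≤ 8 * C / (n:ℝ) := by
      obtain ⟨m, hm⟩ := exists_nat_ge (2 * ‖c‖)
      filter_upwards [eventually_ge_atTop (m + 1)] with n hn
      have hn1 : 1 ≤ n := by omega
      have hn1' : (1:ℝ) ≤ n := by exact_mod_cast hn1
      have hnm : (m:ℝ) ≤ n := by exact_mod_cast (by omega : m ≤ n)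
      have hc : 2 * ‖c‖ ≤ (n:ℝ) ^ 2 := by nlinarith
      have hR : (0:ℝ) < (n:ℝ) ^ 2 / 2 := by positivity
      have := Complex.norm_iteratedDeriv_le_of_forall_mem_sphere_norm_le 2 hR
        (hg.diffContOnCl (s := Metric.ball c ((n:ℝ) ^ 2 / 2))) (C := C * (n:ℝ) ^ 3) (by
          intro z hz
          apply h n hn1
          have h1 : ‖z - c‖ = (n:ℝ) ^ 2 / 2 := by simpa [dist_eq_norm] using hz
          have h2 : ‖z‖ ≤ ‖z - c‖ + ‖c‖ := by simpa using norm_add_le (z - c) c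
          linarith)
      rw [iteratedDeriv_succ, iteratedDeriv_one] at this
      refine this.trans (le_of_eq ?_)
      simp [Nat.factorial]
      field_simp
      ring
    have ht : Tendsto (fun n : ℕ => 8 * C / (n:ℝ)) atTop (nhds 0) :=
      tendsto_const_div_atTop_nhds_zero_nat _
    have := ge_of_tendsto ht hb
    simpa using this
  have h3 : ∀ z, deriv g z = deriv g 0 := fun z => is_const_of_deriv_eq_zero hg' h2 z 0
  refine ⟨g 0, deriv g 0, fun z => ?_⟩
  have hd : Differentiable ℂ (fun z => g z - deriv g 0 * z) := by fun_prop
  have h4 := is_const_of_deriv_eq_zero hd (fun z => by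
    have h5 : HasDerivAt (fun z => g z - deriv g 0 * z) (deriv g z - deriv g 0 * 1) z :=
      (hg z).hasDerivAt.sub ((hasDerivAt_id z).const_mul _)
    rw [h5.deriv, h3 z]; ring) z 0
  simp only [mul_zero, sub_zero] at h4
  linear_combination h4

lemma exists_log (f : ℂ → ℂ) (hf : Differentiable ℂ f) (h0 : ∀ z, f z ≠ 0) :
    ∃ g : ℂ → ℂ, Differentiable ℂ g ∧ ∀ z, f z = Complex.exp (g z) := by
  have hf' : Differentiable ℂ (deriv f) :=
    (hf.contDiff (n := 2)).differentiable_deriv_two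
  have hd : Differentiable ℂ (fun z => deriv f z / f z) := hf'.div hf h0
  obtain ⟨g, hg0, hg⟩ := hd.isExactOn_univ.with_val_at 0 (Complex.log (f 0))
  have hgd : ∀ z, HasDerivAt g (deriv f z / f z) z := fun z => hg z (mem_univ z)
  refine ⟨g, fun z => (hgd z).differentiableAt, fun z => ?_⟩
  have hq : ∀ z, HasDerivAt (fun z => f z * Complex.exp (-g z)) 0 z := by
    intro z
    have := (hf z).hasDerivAt.mul (hgd z).neg.cexp
    refine this.congr_deriv ?_
    have h1 := h0 z
    field_simp
    ring
  have hc := is_const_of_deriv_eq_zero (fun z => (hq z).differentiableAt)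
    (fun z => (hq z).deriv) z 0
  simp only [hg0, Complex.exp_neg, Complex.exp_log (h0 0), mul_inv_cancel₀ (h0 0)] at hc
  have := Complex.exp_ne_zero (g z)
  field_simp at hc
  exact hc

lemma xiF_zero : xiF 0 = 1 := by simp [xiF]
lemma xiF_one : xiF 1 = 1 := by simp [xiF]

lemma completed_two : completedRiemannZeta 2 = Real.pi / 6 := by
  have h := riemannZeta_def_of_ne_zero (s := 2) (by norm_num)
  have hG : Gammaℝ 2 ≠ 0 := Gammaℝ_ne_zero_of_re_pos (by norm_num)
  have hG2 : Gammaℝ 2 = (Real.pi : ℂ)⁻¹ := by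
    rw [Gammaℝ_def]; norm_num [Complex.cpow_neg_one]
  have hp : (Real.pi : ℂ) ≠ 0 := by exact_mod_cast Real.pi_ne_zero
  rw [riemannZeta_two, eq_div_iff hG, hG2] at h
  rw [← h]; field_simp

lemma xiF_two : xiF 2 = Real.pi / 3 := by
  rw [xiF_eq (by norm_num) (by norm_num), completed_two]; ring

lemma zeta0_two : completedRiemannZeta₀ 2 = ((Real.pi / 6 - 1 / 2 : ℝ) : ℂ) := by
  have := completedRiemannZeta_eq 2
  rw [completed_two] at this
  push_cast
  linear_combination -this + (1:ℂ) * (by norm_num : (-1 / 2 - 1 / (1 - 2) : ℂ) = 1/2)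

lemma xiF_ne_zero_real (b : ℝ) (h0 : 0 < b) (h1 : b < 1) : xiF b ≠ 0 := by
  intro h
  have hz := zeta0_le b 1 (by simp; linarith) (by simp; linarith)
  rw [ofReal_one, mul_one, zeta0_two, Complex.norm_real, Real.norm_of_nonneg
    (by linarith [Real.pi_gt_three])] at hz
  have h2 : (b * (1 - b) : ℂ) * completedRiemannZeta₀ b = 1 := by
    unfold xiF at h; linear_combination -h
  have h3 := congrArg norm h2
  rw [norm_mul, norm_one, ← ofReal_one, ← ofReal_sub, ← ofReal_mul, Complex.norm_real,
    Real.norm_of_nonneg (by nlinarith)] at h3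
  have h4 : b * (1 - b) ≤ 1 := by nlinarith
  have h5 : b * (1 - b) * ‖completedRiemannZeta₀ b‖ ≤ 1 * ‖completedRiemannZeta₀ b‖ := by gcongr
  linarith [Real.pi_lt_d2]

lemma xiF_has_zero : ∃ s, xiF s = 0 := by
  by_contra! hne
  obtain ⟨g, hg, hfg⟩ := exists_log xiF xiF_diff hne
  have hgrow : ∀ n : ℕ, 1 ≤ n → ∀ z, ‖z‖ ≤ (n:ℝ) ^ 2 →
      ‖g z‖ ≤ (100 + 3 * ‖g 0‖) * (n:ℝ) ^ 3 := by
    intro n hn z hz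
    have hn' : (1:ℝ) ≤ n := by exact_mod_cast hn
    have hM : ∀ w, ‖w‖ < 2 * (n:ℝ) ^ 2 → (g w).re ≤ 50 * (n:ℝ) ^ 3 := by
      intro w hw
      have h1 := xiF_le (n ^ 2 + 1) (by omega) w (by push_cast; linarith)
      rw [hfg, Complex.norm_exp, ← Real.le_log_iff_exp_le (by positivity),
        Real.log_mul (by norm_num) (by positivity), Real.log_pow] at h1
      have h2 : Real.log 33 ≤ 32 := by
        have := Real.log_le_sub_one_of_pos (show (0:ℝ) < 33 by norm_num); linarith
      have h3 : Real.log ((n ^ 2 + 1 : ℕ) : ℝ) ≤ 2 * n := by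
        have : ((n ^ 2 + 1 : ℕ) : ℝ) ≤ ((n:ℝ) + 1) ^ 2 := by push_cast; nlinarith
        have h4 := Real.log_le_log (by positivity) this
        rw [Real.log_pow] at h4
        have h5 := Real.log_le_sub_one_of_pos (show (0:ℝ) < (n:ℝ) + 1 by positivity)
        push_cast at h4 ⊢
        linarith
      have h6 : ((n ^ 2 + 1 + 2 : ℕ) : ℝ) * Real.log ((n ^ 2 + 1 : ℕ) : ℝ)
          ≤ ((n ^ 2 + 1 + 2 : ℕ) : ℝ) * (2 * n) := by gcongr
      push_cast at h1 h6
      have h7 : (1:ℝ) ≤ (n:ℝ) ^ 3 := one_le_pow₀ hn'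
      have h8 : (n:ℝ) ≤ (n:ℝ) ^ 3 := by nlinarith [sq_nonneg ((n:ℝ) - 1)]
      nlinarith
    have hnn : (1:ℝ) ≤ (n:ℝ) ^ 2 := one_le_pow₀ hn'
    have hb := Complex.borelCaratheodory (f := g) (M := 50 * (n:ℝ) ^ 3) (R := 2 * (n:ℝ) ^ 2) (z := z)
      (by positivity) hg.differentiableOn
      (fun w hw => hM w (by simpa using hw)) (by positivity) (by simp; linarith)
    have hden : (n:ℝ) ^ 2 ≤ 2 * (n:ℝ) ^ 2 - ‖z‖ := by linarith
    have hpos : (0:ℝ) < (n:ℝ) ^ 2 := by linarith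
    have b1 : 2 * (50 * (n:ℝ) ^ 3) * ‖z‖ / (2 * (n:ℝ) ^ 2 - ‖z‖) ≤ 100 * (n:ℝ) ^ 3 := by
      rw [div_le_iff₀ (by linarith)]
      have : (0:ℝ) ≤ 100 * (n:ℝ) ^ 3 := by positivity
      nlinarith
    have b2 : ‖g 0‖ * (2 * (n:ℝ) ^ 2 + ‖z‖) / (2 * (n:ℝ) ^ 2 - ‖z‖) ≤ 3 * ‖g 0‖ := by
      rw [div_le_iff₀ (by linarith)]
      nlinarith [norm_nonneg (g 0)]
    have b3 : 3 * ‖g 0‖ ≤ 3 * ‖g 0‖ * (n:ℝ) ^ 3 :=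
      le_mul_of_one_le_right (by positivity) (one_le_pow₀ hn')
    nlinarith
  obtain ⟨a, b, hab⟩ := affine_of_growth g hg _ hgrow
  have e0 := hfg 0
  have e1 := hfg 1
  have e2 := hfg 2
  rw [xiF_zero, hab] at e0
  rw [xiF_one, hab, Complex.exp_add] at e1
  rw [xiF_two, hab, Complex.exp_add, show b * 2 = b * 1 + b * 1 by ring, Complex.exp_add] at e2
  rw [mul_zero, add_zero] at e0
  rw [← e0, one_mul] at e1 e2
  rw [← e1, mul_one] at e2
  have : Real.pi / 3 = 1 := by exact_mod_cast e2
  linarith [Real.pi_gt_d2]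

lemma xiF_one_sub (s : ℂ) : xiF (1 - s) = xiF s := by
  unfold xiF; rw [completedRiemannZeta₀_one_sub]; ring

lemma xiF_zero_right : ∃ s : ℂ, xiF s = 0 ∧ 1 / 2 ≤ s.re := by
  obtain ⟨s, hs⟩ := xiF_has_zero
  rcases le_total (1 / 2) s.re with h | h
  · exact ⟨s, hs, h⟩
  · exact ⟨1 - s, by rw [xiF_one_sub, hs], by simp; linarith⟩

/-- entire version of `(s-1) ζ(s)` -/
noncomputable def HF (s : ℂ) : ℂ :=
  xiF s * ((2 : ℂ)⁻¹ * (Real.pi : ℂ) ^ (s / 2)) * (Complex.Gamma (s / 2 + 1))⁻¹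

lemma HF_diff : Differentiable ℂ HF := by
  have h1 := xiF_diff
  have h2 : Differentiable ℂ (fun s : ℂ => (Complex.Gamma (s / 2 + 1))⁻¹) :=
    Complex.differentiable_one_div_Gamma.comp (by fun_prop : Differentiable ℂ (fun s : ℂ => s / 2 + 1))
  have h3 : Differentiable ℂ (fun s : ℂ => (Real.pi : ℂ) ^ (s / 2)) := by
    intro s
    have : (Real.pi : ℂ) ≠ 0 := by exact_mod_cast Real.pi_ne_zero
    exact DifferentiableAt.const_cpow (by fun_prop) (Or.inl this)
  unfold HF
  exact (h1.mul (h3.const_mul _)).mul h2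

lemma HF_eq {s : ℂ} (h1 : s ≠ 1) : HF s = (s - 1) * riemannZeta s := by
  have h : 1 - s ≠ 0 := sub_ne_zero.2 (Ne.symm h1)
  rw [riemannZeta_eq_mul_completedRiemannZeta₀, HF, xiF, neg_div, Complex.cpow_neg]
  have e : (s - 1) * (s * completedRiemannZeta₀ s - 1 - s / (1 - s)) =
      s * (s - 1) * completedRiemannZeta₀ s + 1 := by
    field_simp; ring
  rw [← mul_div_assoc, e]
  simp only [div_eq_mul_inv, mul_inv, inv_inv]
  ring

end PartB
section PartC
open Complex MeasureTheory Set

/-- the generalized integer attached to a pair -/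
noncomputable def lamP (β : ℝ) (p : ℕ × ℕ) : ℝ := (p.1 : ℝ) * (p.2 : ℝ) ^ (1 / β)

/-- the coefficient attached to a pair -/
noncomputable def coefP (p : ℕ × ℕ) : ℂ := ((moebius p.1 : ℤ) : ℂ) * ((moebius p.2 : ℤ) : ℂ)

lemma coefP_ne {p : ℕ × ℕ} (h : coefP p ≠ 0) : 1 ≤ p.1 ∧ 1 ≤ p.2 := by
  constructor
  · by_contra h'
    have : p.1 = 0 := by omega
    exact h (by simp [coefP, this])
  · by_contra h'
    have : p.2 = 0 := by omega
    exact h (by simp [coefP, this])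

lemma lamP_bounds {β : ℝ} (hβ : β ∈ Ioo (0:ℝ) 1) {p : ℕ × ℕ} (h : 1 ≤ p.1 ∧ 1 ≤ p.2) :
    1 ≤ lamP β p ∧ (p.1 : ℝ) ≤ lamP β p ∧ (p.2 : ℝ) ≤ lamP β p := by
  have h1 : (1:ℝ) ≤ p.1 := by exact_mod_cast h.1
  have h2 : (1:ℝ) ≤ p.2 := by exact_mod_cast h.2
  have hb : 1 ≤ 1 / β := by rw [le_div_iff₀ hβ.1]; linarith [hβ.2]
  have h3 : (p.2:ℝ) ≤ (p.2:ℝ) ^ (1 / β) := Real.self_le_rpow_of_one_le h2 hb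
  unfold lamP
  refine ⟨?_, ?_, ?_⟩ <;> nlinarith

/-- truncated coefficient -/
noncomputable def truncP (β : ℝ) (p : ℕ × ℕ) (x : ℝ) : ℂ :=
  if lamP β p ≤ x then coefP p else 0

lemma truncP_support {β : ℝ} (hβ : β ∈ Ioo (0:ℝ) 1) {x : ℝ} {K : ℕ} (hx : x ≤ K) (p : ℕ × ℕ)
    (hp : p ∉ Finset.range (K + 1) ×ˢ Finset.range (K + 1)) : truncP β p x = 0 := by
  unfold truncP
  split_ifs with h
  · by_contra hc
    have hb := lamP_bounds hβ (coefP_ne hc)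
    apply hp
    rw [Finset.mem_product, Finset.mem_range, Finset.mem_range, Nat.lt_succ_iff, Nat.lt_succ_iff]
    constructor
    · exact_mod_cast (hb.2.1.trans h).trans hx
    · exact_mod_cast (hb.2.2.trans h).trans hx
  · rfl

lemma MobPairSum_eq_sum {β : ℝ} (hβ : β ∈ Ioo (0:ℝ) 1) {x : ℝ} {K : ℕ} (hx : x ≤ K) :
    (MobPairSum β x : ℂ) = ∑ p ∈ Finset.range (K + 1) ×ˢ Finset.range (K + 1), truncP β p x := by
  set S := {mn : ℕ × ℕ | 0 < mn.1 ∧ 0 < mn.2 ∧ (mn.1 : ℝ) * (mn.2 : ℝ) ^ (1/β) ≤ x} with hS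
  have key : ∀ p : ℕ × ℕ, ((S.indicator (fun mn : ℕ × ℕ => moebius mn.1 * moebius mn.2) p : ℤ) : ℂ)
      = truncP β p x := by
    intro p
    unfold truncP
    by_cases h : p ∈ S
    · rw [indicator_of_mem h, if_pos (show lamP β p ≤ x from h.2.2)]
      simp [coefP]
    · rw [indicator_of_notMem h]
      split_ifs with h2
      · by_contra hc
        have := coefP_ne (fun h0 => hc (by rw [h0]; simp))
        exact h ⟨this.1, this.2, h2⟩
      · simp
  unfold MobPairSum
  rw [finsum_mem_def, finsum_eq_sum_of_support_subset
    (s := Finset.range (K + 1) ×ˢ Finset.range (K + 1))]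
  · rw [Int.cast_sum]
    exact Finset.sum_congr rfl fun p _ => key p
  · intro p hp
    by_contra hc
    have h0 := truncP_support hβ hx p (by simpa using hc)
    rw [← key p] at h0
    exact hp (by exact_mod_cast h0)

lemma MobPairSum_eq_tsum {β : ℝ} (hβ : β ∈ Ioo (0:ℝ) 1) (x : ℝ) :
    (MobPairSum β x : ℂ) = ∑' p, truncP β p x := by
  obtain ⟨K, hK⟩ := exists_nat_ge x
  rw [MobPairSum_eq_sum hβ hK, tsum_eq_sum]
  exact fun p hp => truncP_support hβ hK p hp

lemma truncP_meas (β : ℝ) (p : ℕ × ℕ) : Measurable (truncP β p) := by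
  unfold truncP
  exact Measurable.ite measurableSet_Ici measurable_const measurable_const

lemma MobPairSum_locInt {β : ℝ} (hβ : β ∈ Ioo (0:ℝ) 1) :
    LocallyIntegrableOn (fun x : ℝ => (MobPairSum β x : ℂ)) (Ioi 0) := by
  refine LocallyIntegrable.locallyIntegrableOn ?_ _
  rw [locallyIntegrable_iff]
  intro k hk
  obtain ⟨B, hB⟩ := hk.bddAbove
  obtain ⟨K, hK⟩ := exists_nat_ge B
  have h1 : IntegrableOn (fun x : ℝ =>
      ∑ p ∈ Finset.range (K + 1) ×ˢ Finset.range (K + 1), truncP β p x) k := by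
    refine integrable_finsetSum _ fun p _ => ?_
    refine Measure.integrableOn_of_bounded (M := ‖coefP p‖) hk.measure_lt_top.ne
      (truncP_meas β p).aestronglyMeasurable (Eventually.of_forall fun x => ?_)
    unfold truncP
    split_ifs <;> simp
  refine h1.congr_fun (fun x hx => ?_) hk.measurableSet
  exact (MobPairSum_eq_sum hβ ((hB hx).trans hK)).symm

lemma MobPairSum_small {β : ℝ} (hβ : β ∈ Ioo (0:ℝ) 1) {x : ℝ} (hx : x < 1) :
    (MobPairSum β x : ℂ) = 0 := by
  rw [MobPairSum_eq_tsum hβ]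
  have : ∀ p, truncP β p x = 0 := by
    intro p
    unfold truncP
    split_ifs with h
    · by_contra hc
      have hb := lamP_bounds hβ (coefP_ne hc)
      linarith [hb.1]
    · rfl
  simp [this]

lemma mellin_diff {β : ℝ} (hβ : β ∈ Ioo (0:ℝ) 1) {θ : ℝ}
    (h : (fun x : ℝ => (MobPairSum β x : ℝ)) =O[atTop] fun x => x ^ θ) {s : ℂ} (hs : θ < s.re) :
    DifferentiableAt ℂ (fun s => mellin (fun x : ℝ => (MobPairSum β x : ℂ)) (-s)) s := by
  have h1 : (fun x : ℝ => (MobPairSum β x : ℂ)) =O[atTop] fun x => x ^ (-(-θ)) := by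
    rw [neg_neg]
    refine (IsBigO.of_norm_left ?_)
    refine h.norm_left.congr_left fun x => ?_
    simp [Complex.norm_intCast]
  have h2 : (fun x : ℝ => (MobPairSum β x : ℂ)) =O[nhdsWithin 0 (Ioi 0)]
      fun x => x ^ (-((-s).re - 1)) := by
    have : (fun x : ℝ => (MobPairSum β x : ℂ)) =ᶠ[nhdsWithin 0 (Ioi 0)] fun _ => 0 := by
      filter_upwards [nhdsWithin_le_nhds (Iio_mem_nhds one_pos)] with x hx
      exact MobPairSum_small hβ hx
    exact this.trans_isBigO (isBigO_zero _ _)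
  have := mellin_differentiableAt_of_isBigO_rpow (s := -s) (MobPairSum_locInt hβ) h1
    (by simpa using hs) h2 (by linarith)
  exact this.comp s differentiableAt_id.neg

lemma term_integral {β : ℝ} (hβ : β ∈ Ioo (0:ℝ) 1) {s : ℂ} (hs : 0 < s.re) (p : ℕ × ℕ) :
    IntegrableOn (fun t : ℝ => (t : ℂ) ^ (-s - 1) • truncP β p t) (Ioi 0) ∧
    ∫ t in Ioi (0:ℝ), (t : ℂ) ^ (-s - 1) • truncP β p t = coefP p * (lamP β p : ℂ) ^ (-s) / s ∧
    ∫ t in Ioi (0:ℝ), ‖(t : ℂ) ^ (-s - 1) • truncP β p t‖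
      = ‖coefP p * (lamP β p : ℂ) ^ (-s)‖ / s.re := by
  by_cases hc : coefP p = 0
  · simp [truncP, hc]
  have hl := (lamP_bounds hβ (coefP_ne hc)).1
  have hl0 : 0 < lamP β p := by linarith
  have hs0 : s ≠ 0 := by rintro rfl; simp at hs
  have hre : (-s - 1).re < -1 := by simp; linarith
  have e : ∀ t : ℝ, (t : ℂ) ^ (-s - 1) • truncP β p t =
      (Ici (lamP β p)).indicator (fun t : ℝ => (t : ℂ) ^ (-s - 1) * coefP p) t := by
    intro t
    unfold truncP
    by_cases h : lamP β p ≤ t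
    · rw [indicator_of_mem (by exact h), if_pos h, smul_eq_mul]
    · rw [indicator_of_notMem (by exact h), if_neg h, smul_zero]
  have hsub : Ioi (0:ℝ) ∩ Ici (lamP β p) = Ici (lamP β p) :=
    inter_eq_right.2 fun t ht => lt_of_lt_of_le hl0 ht
  have hi : IntegrableOn (fun t : ℝ => (t : ℂ) ^ (-s - 1) * coefP p) (Ioi (lamP β p)) :=
    (integrableOn_Ioi_cpow_of_lt hre hl0).mul_const _
  have hi' : IntegrableOn (fun t : ℝ => (t : ℂ) ^ (-s - 1) * coefP p) (Ici (lamP β p)) :=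
    (integrableOn_Ici_iff_integrableOn_Ioi (by finiteness)).2 hi
  simp_rw [e]
  refine ⟨?_, ?_, ?_⟩
  · rw [integrableOn_indicator_iff measurableSet_Ici, inter_comm, hsub]
    exact hi'
  · rw [setIntegral_indicator measurableSet_Ici, hsub, integral_Ici_eq_integral_Ioi,
      integral_mul_const, integral_Ioi_cpow_of_lt hre hl0]
    have : -s - 1 + 1 = -s := by ring
    rw [this]
    field_simp
  · simp_rw [norm_indicator_eq_indicator_norm]
    rw [setIntegral_indicator measurableSet_Ici, hsub, integral_Ici_eq_integral_Ioi]
    have e2 : ∫ t in Ioi (lamP β p), ‖(t : ℂ) ^ (-s - 1) * coefP p‖ =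
        ∫ t in Ioi (lamP β p), t ^ (-s.re - 1) * ‖coefP p‖ := by
      refine setIntegral_congr_fun measurableSet_Ioi fun t ht => ?_
      have ht0 : 0 < t := hl0.trans ht
      simp only [norm_mul]
      rw [Complex.norm_cpow_eq_rpow_re_of_pos ht0]
      simp
    rw [e2, integral_mul_const, integral_Ioi_rpow_of_lt (by linarith) hl0, norm_mul,
      Complex.norm_cpow_eq_rpow_re_of_pos hl0]
    have : -s.re - 1 + 1 = -s.re := by ring
    rw [this, neg_re]
    field_simp

lemma term_eq {β : ℝ} (hβ : β ∈ Ioo (0:ℝ) 1) {s : ℂ} (p : ℕ × ℕ) :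
    coefP p * (lamP β p : ℂ) ^ (-s) =
      LSeries.term (fun n => ((moebius n : ℤ) : ℂ)) s p.1 *
      LSeries.term (fun n => ((moebius n : ℤ) : ℂ)) (s / β) p.2 := by
  by_cases h1 : p.1 = 0
  · simp [coefP, h1]
  by_cases h2 : p.2 = 0
  · simp [coefP, h2]
  rw [LSeries.term_of_ne_zero h1, LSeries.term_of_ne_zero h2, lamP, coefP]
  have hp2 : (0:ℝ) ≤ (p.2:ℝ) := by positivity
  rw [ofReal_mul, mul_cpow_ofReal_nonneg (by positivity) (by positivity), ofReal_cpow hp2]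
  rw [ofReal_natCast, ofReal_natCast]
  have : ((p.2 : ℂ) ^ ((1 / β : ℝ) : ℂ)) ^ (-s) = (p.2 : ℂ) ^ (-(s / β)) := by
    rw [← ofReal_natCast, ← ofReal_cpow hp2]
    rw [Complex.cpow_def_of_ne_zero (by
      have : (0:ℝ) < p.2 := by exact_mod_cast Nat.pos_of_ne_zero h2
      exact_mod_cast (Real.rpow_pos_of_pos this _).ne'), 
      Complex.cpow_def_of_ne_zero (by exact_mod_cast h2), ← ofReal_log (by positivity),
      ← ofReal_log hp2, Real.log_rpow (by exact_mod_cast Nat.pos_of_ne_zero h2)]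
    congr 1
    push_cast
    ring
  rw [this, cpow_neg, cpow_neg]
  ring

lemma mellin_identity {β : ℝ} (hβ : β ∈ Ioo (0:ℝ) 1) {s : ℂ} (hs : 1 < s.re) :
    s * mellin (fun x : ℝ => (MobPairSum β x : ℂ)) (-s) * riemannZeta s * riemannZeta (s / β) = 1 := by
  have hs0 : s ≠ 0 := by rintro rfl; simp at hs; linarith
  have hsb : 1 < (s / β).re := by
    rw [Complex.div_ofReal_re, lt_div_iff₀ hβ.1]; linarith [hβ.2]
  have S1 : Summable (LSeries.term (fun n => ((moebius n : ℤ) : ℂ)) s) :=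
    LSeriesSummable_moebius_iff.2 hs
  have S2 : Summable (LSeries.term (fun n => ((moebius n : ℤ) : ℂ)) (s / β)) :=
    LSeriesSummable_moebius_iff.2 hsb
  have S3 : Summable (fun p : ℕ × ℕ => ‖coefP p * (lamP β p : ℂ) ^ (-s)‖) := by
    simp_rw [term_eq hβ]
    exact summable_mul_of_summable_norm S1.norm S2.norm |>.norm
  have hsum := hasSum_integral_of_summable_integral_norm (μ := volume.restrict (Ioi (0:ℝ)))
    (F := fun (p : ℕ × ℕ) (t : ℝ) => (t : ℂ) ^ (-s - 1) • truncP β p t)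
    (fun p => (term_integral hβ (by linarith) p).1)
    (by
      simp_rw [fun p => (term_integral hβ (s := s) (by linarith) p).2.2]
      exact S3.div_const _)
  have e1 : mellin (fun x : ℝ => (MobPairSum β x : ℂ)) (-s) =
      ∫ t in Ioi (0:ℝ), ∑' p, (t : ℂ) ^ (-s - 1) • truncP β p t := by
    rw [mellin]
    congr 1
    ext t
    rw [MobPairSum_eq_tsum hβ, smul_eq_mul, ← tsum_mul_left]
    rfl
  rw [← e1] at hsum
  simp_rw [fun p => (term_integral hβ (s := s) (by linarith) p).2.1] at hsum
  have e2 := hsum.tsum_eq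
  rw [tsum_div_const] at e2
  simp_rw [term_eq hβ] at e2
  rw [← tsum_mul_tsum_of_summable_norm S1.norm S2.norm] at e2
  have L1 := LSeries_one_mul_Lseries_moebius hs
  have L2 := LSeries_one_mul_Lseries_moebius hsb
  rw [LSeries_one_eq_riemannZeta hs] at L1
  rw [LSeries_one_eq_riemannZeta hsb] at L2
  unfold LSeries at L1 L2
  rw [← e2, mul_div_cancel₀ _ hs0]
  calc _ = (riemannZeta s * ∑' n, LSeries.term (fun n => ((moebius n : ℤ) : ℂ)) s n) *
        (riemannZeta (s / β) * ∑' n, LSeries.term (fun n => ((moebius n : ℤ) : ℂ)) (s / β) n) := by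
        ring
    _ = 1 := by rw [L1, L2, one_mul]

lemma no_bound {β : ℝ} (hβ : β ∈ Ioo (0:ℝ) 1) {θ : ℝ} (hθ : θ < 1 / 2)
    (h : (fun x : ℝ => (MobPairSum β x : ℝ)) =O[atTop] fun x => x ^ θ) : False := by
  obtain ⟨ρ, hρ, hρre⟩ := xiF_zero_right
  set U : Set ℂ := {s | θ < s.re} with hU
  have hUo : IsOpen U := isOpen_lt continuous_const continuous_re
  have hUc : IsPreconnected U := (convex_halfSpace_re_gt θ).isPreconnected
  have hb0 : (β : ℂ) ≠ 0 := by exact_mod_cast hβ.1.ne'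
  let f : ℂ → ℂ := fun s => s * mellin (fun x : ℝ => (MobPairSum β x : ℂ)) (-s) * HF s * HF (s / β)
  let g : ℂ → ℂ := fun s => (s - 1) * (s / β - 1)
  have hf : AnalyticOnNhd ℂ f U := by
    refine DifferentiableOn.analyticOnNhd (fun s hs => ?_) hUo
    have h1 := mellin_diff hβ h hs
    have h2 := HF_diff s
    have h3 : DifferentiableAt ℂ (fun s : ℂ => HF (s / β)) s :=
      DifferentiableAt.fun_comp' s (HF_diff (s / β))
        (by fun_prop : DifferentiableAt ℂ (fun s : ℂ => s / β) s)
    exact (((differentiableAt_id.mul h1).mul h2).mul h3).differentiableWithinAt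
  have hg : AnalyticOnNhd ℂ g U := by
    refine DifferentiableOn.analyticOnNhd (fun s hs => ?_) hUo
    have : DifferentiableAt ℂ g s := by fun_prop
    exact this.differentiableWithinAt
  have heq : EqOn f g U := by
    refine hf.eqOn_of_preconnected_of_eventuallyEq hg hUc (z₀ := 2)
      (by simp [hU]; linarith) ?_
    have : {s : ℂ | 1 < s.re} ∈ nhds (2 : ℂ) :=
      (isOpen_lt continuous_const continuous_re).mem_nhds (by simp)
    filter_upwards [this] with s hs
    have hs' : 1 < s.re := hs
    have hsb : 1 < (s / β).re := by
      rw [Complex.div_ofReal_re, lt_div_iff₀ hβ.1]; linarith [hβ.2]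
    have n1 : s ≠ 1 := by rintro rfl; simp at hs'
    have n2 : s / β ≠ 1 := by intro h; rw [h] at hsb; simp at hsb
    simp only [f, g]
    rw [HF_eq n1, HF_eq n2]
    linear_combination ((s - 1) * (s / β - 1)) * mellin_identity hβ hs'
  have hval : f ρ = g ρ := heq (by simp only [hU, mem_ofPred_eq]; linarith)
  have hH : HF ρ = 0 := by simp [HF, hρ]
  simp only [f, g, hH, mul_zero, zero_mul] at hval
  rcases mul_eq_zero.1 hval.symm with h1 | h1
  · rw [sub_eq_zero.1 h1, xiF_one] at hρ
    exact one_ne_zero hρ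
  · have : ρ = β := by
      have := sub_eq_zero.1 h1
      field_simp at this
      exact this
    rw [this] at hρ
    exact xiF_ne_zero_real β hβ.1 hβ.2 hρ

end PartC

theorem stmt14 (β : ℝ) (hβ : β ∈ Set.Ioo (0:ℝ) 1) :
    ¬ ∃ θ : ℝ, θ < 1/2 ∧
      ((fun x : ℝ => (MobPairSum β x : ℝ)) =O[atTop] fun x => x ^ θ) := by
  rintro ⟨θ, hθ, h⟩
  exact no_bound hβ hθ h
end

section
/- Let 𝒫 be the Beurling generalized prime system with pₙ = 2^{2^n} for n = 0, 1, 2, …. Then for every real x ≥ 1, M_𝒫(x) ∈ {−1, 0, 1}. Equivalently, for every natural number N, the partial sum Σ_{k=0}^{N} (−1)^{s₂(k)} lies in {−1, 0, 1}, where s₂(k) denotes the number of ones in the binary expansion of k. -/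
open Filter Asymptotics

/-- M_𝒫(x): sum of (−1)^|S| over finite S ⊆ ℕ with ∏_{i∈S} pᵢ ≤ x. -/
noncomputable def MP (p : ℕ → ℝ) (x : ℝ) : ℝ :=
  ∑ᶠ S ∈ {S : Finset ℕ | ∏ i ∈ S, p i ≤ x}, (-1 : ℝ) ^ S.card

theorem digits_bitIndices (k : ℕ) : (Nat.digits 2 k).sum = k.bitIndices.length := by
  induction k using Nat.strong_induction_on with
  | _ k ih =>
    rcases Nat.eq_zero_or_pos k with h | h
    · subst h; simp
    · rw [Nat.digits_def' (by norm_num) h, List.sum_cons, ih (k / 2) (by omega)]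
      obtain ⟨m, hm⟩ : ∃ m, k = 2 * m ∨ k = 2 * m + 1 := ⟨k / 2, by omega⟩
      rcases hm with rfl | rfl
      · have h1 : 2 * m / 2 = m := by omega
        have h2 : 2 * m % 2 = 0 := by omega
        rw [h1, h2, Nat.bitIndices_two_mul]; simp
      · have h1 : (2 * m + 1) / 2 = m := by omega
        have h2 : (2 * m + 1) % 2 = 1 := by omega
        rw [h1, h2, Nat.bitIndices_two_mul_add_one]; simp; omega

theorem sum_even_zero (m : ℕ) :
    ∑ k ∈ Finset.range (2 * m), (-1 : ℤ) ^ (Nat.digits 2 k).sum = 0 := by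
  induction m with
  | zero => simp
  | succ m ih =>
    rw [show 2 * (m + 1) = 2 * m + 1 + 1 by ring, Finset.sum_range_succ, Finset.sum_range_succ, ih,
      digits_bitIndices, digits_bitIndices, Nat.bitIndices_two_mul, Nat.bitIndices_two_mul_add_one]
    simp [pow_succ]

theorem tm_sum_mem (N : ℕ) :
    (∑ k ∈ Finset.range (N + 1), (-1 : ℤ) ^ (Nat.digits 2 k).sum)
        ∈ ({-1, 0, 1} : Set ℤ) := by
  obtain ⟨m, hm⟩ : ∃ m, N + 1 = 2 * m ∨ N + 1 = 2 * m + 1 := ⟨(N + 1) / 2, by omega⟩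
  rcases hm with h | h
  · rw [h, sum_even_zero]; simp
  · rw [h, Finset.sum_range_succ, sum_even_zero, zero_add]
    rcases neg_one_pow_eq_or ℤ (Nat.digits 2 (2 * m)).sum with h | h <;> rw [h] <;> simp

theorem MP_eq (x : ℝ) (hx : 1 ≤ x) : MP (fun n => (2 : ℝ) ^ (2 ^ n)) x =
    ((∑ k ∈ Finset.range (Nat.log 2 ⌊x⌋₊ + 1), (-1 : ℤ) ^ (Nat.digits 2 k).sum : ℤ) : ℝ) := by
  have hs : {S : Finset ℕ | ∏ i ∈ S, (fun n => (2 : ℝ) ^ (2 ^ n)) i ≤ x} =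
      ((Finset.range (Nat.log 2 ⌊x⌋₊ + 1)).map Finset.equivBitIndices.toEmbedding :
        Finset (Finset ℕ)) := by
    ext S
    obtain ⟨k, rfl⟩ := Finset.equivBitIndices.surjective S
    have hk : ∑ i ∈ Finset.equivBitIndices k, 2 ^ i = k :=
      Finset.equivBitIndices.symm_apply_apply k
    have hf : ⌊x⌋₊ ≠ 0 := by
      have := Nat.le_floor (a := x) (n := 1) (by simpa using hx)
      omega
    simp only [Set.mem_ofPred_eq, Finset.prod_pow_eq_pow_sum, hk]
    have h1 : ((2 : ℝ) ^ k ≤ x) ↔ k ≤ Nat.log 2 ⌊x⌋₊ := by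
      rw [Nat.le_log_iff_pow_le (by norm_num) hf, Nat.le_floor_iff (by linarith)]
      push_cast; rfl
    rw [h1]
    rw [Finset.mem_coe, ← Equiv.coe_toEmbedding, Finset.mem_map', Finset.mem_range, Nat.lt_succ_iff]
  unfold MP
  rw [hs, finsum_mem_coe_finset, Finset.sum_map]
  push_cast
  refine Finset.sum_congr rfl fun k _ => ?_
  rw [digits_bitIndices]
  congr 1
  simp [Finset.equivBitIndices, List.toFinset_card_of_nodup, Nat.bitIndices_sorted.nodup]

theorem stmt15 :
    (∀ x : ℝ, 1 ≤ x →
      MP (fun n => (2 : ℝ) ^ (2 ^ n)) x ∈ ({-1, 0, 1} : Set ℝ)) ∧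
    (∀ N : ℕ,
      (∑ k ∈ Finset.range (N + 1), (-1 : ℤ) ^ (Nat.digits 2 k).sum)
        ∈ ({-1, 0, 1} : Set ℤ)) := by
  refine ⟨fun x hx => ?_, tm_sum_mem⟩
  rw [MP_eq x hx]
  rcases tm_sum_mem (Nat.log 2 ⌊x⌋₊) with h | h | h <;> rw [h] <;> simp
end
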